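/- Let w(x₁,x₂) = -|x₁|^{4/3} on ℝ², so that |Dw(x)| = (4/3)|x₁|^{1/3} for x₁ ≠ 0. Then for every p > 2 and every α ∈ (3/2, 3 - 3/p), the function |D|Dw|^α|^p = C(α,p) |x₁|^{(α-3)p/3} (where (3-α)p/3 > 1) is not locally integrable near the line {x₁ = 0}; consequently |Dw|^α ∉ W^{1,p}_loc(ℝ²), i.e. there is no weak gradient of |Dw|^α lying in L^p_loc(ℝ²;ℝ²). -/

import Mathlib

open MeasureTheory Metric
open scoped ENNReal RealInnerProductSpace BigOperators

noncomputable section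

abbrev E2 : Type := EuclideanSpace ℝ (Fin 2)

/-- Partial derivative in the `i`-th coordinate direction. -/
def pd (i : Fin 2) (φ : E2 → ℝ) (x : E2) : ℝ :=
  fderiv ℝ φ x (EuclideanSpace.single i 1)

/-- Second partial derivative. -/
def pd2 (i j : Fin 2) (φ : E2 → ℝ) (x : E2) : ℝ :=
  pd i (pd j φ) x

/-- The ∞-Laplacian `Δ_∞ φ = Σ_{i,j} φ_i φ_j φ_{ij}`. -/
def infLap (φ : E2 → ℝ) (x : E2) : ℝ :=
  ∑ i : Fin 2, ∑ j : Fin 2, pd i φ x * pd j φ x * pd2 i j φ x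

/-- The ordinary Laplacian. -/
def lap (φ : E2 → ℝ) (x : E2) : ℝ := pd2 0 0 φ x + pd2 1 1 φ x

/-- `|Dφ|²`. -/
def gradSq (φ : E2 → ℝ) (x : E2) : ℝ := ∑ i : Fin 2, (pd i φ x) ^ 2

/-- `|D²φ Dφ|²`. -/
def hessGradSq (φ : E2 → ℝ) (x : E2) : ℝ :=
  ∑ i : Fin 2, (∑ j : Fin 2, pd2 i j φ x * pd j φ x) ^ 2

/-- Viscosity solution of `-Δ_∞ u = f` on `Ω`. -/
def IsViscositySol (Ω : Set E2) (f u : E2 → ℝ) : Prop :=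
  ∀ φ : E2 → ℝ, ContDiff ℝ 2 φ →
    (∀ x₀ ∈ Ω, IsLocalMaxOn (fun y => u y - φ y) Ω x₀ → -infLap φ x₀ ≤ f x₀) ∧
    (∀ x₀ ∈ Ω, IsLocalMinOn (fun y => u y - φ y) Ω x₀ → f x₀ ≤ -infLap φ x₀)

/-- `G` is a weak gradient of `v` on `Ω`. -/
def HasWeakGradOn (v : E2 → ℝ) (G : E2 → E2) (Ω : Set E2) : Prop :=
  LocallyIntegrableOn v Ω volume ∧ LocallyIntegrableOn (fun x => ‖G x‖) Ω volume ∧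
    ∀ φ : E2 → ℝ, ContDiff ℝ (⊤ : ℕ∞) φ → HasCompactSupport φ → tsupport φ ⊆ Ω →
      ∀ i : Fin 2, ∫ x in Ω, v x * pd i φ x = - ∫ x in Ω, G x i * φ x

/-- `G ∈ L^p_loc(Ω; ℝ²)`. -/
def MemLpLocOn (G : E2 → E2) (p : ℝ) (Ω : Set E2) : Prop :=
  ∀ K : Set E2, K ⊆ Ω → IsCompact K → IntegrableOn (fun x => ‖G x‖ ^ p) K volume

/-- `v ∈ W^{1,p}_loc(Ω)`: there is a weak gradient of `v` lying in `L^p_loc(Ω;ℝ²)`. -/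
def MemW1pLoc (v : E2 → ℝ) (p : ℝ) (Ω : Set E2) : Prop :=
  ∃ G : E2 → E2, HasWeakGradOn v G Ω ∧ MemLpLocOn G p Ω

/-- Divergence of a vector field. -/
def divg (Φ : E2 → E2) (x : E2) : ℝ := ∑ i : Fin 2, pd i (fun y => Φ y i) x

/-- The admissible pairings defining the BV norm of `f` on `U`. -/
def bvPairings (f : E2 → ℝ) (U : Set E2) : Set ℝ :=
  { r | ∃ Φ : E2 → E2, ContDiff ℝ 1 Φ ∧ HasCompactSupport Φ ∧ tsupport Φ ⊆ U ∧
      (∀ x, ‖Φ x‖ ≤ 1) ∧ r = ∫ x in U, f x * divg Φ x }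

/-- `‖f‖_{BV(U)}`. -/
def bvNorm (f : E2 → ℝ) (U : Set E2) : ℝ := sSup (bvPairings f U)

/-- `f ∈ BV_loc(Ω)`. -/
def BVloc (f : E2 → ℝ) (Ω : Set E2) : Prop :=
  ∀ U : Set E2, IsOpen U → IsCompact (closure U) → closure U ⊆ Ω →
    BddAbove (bvPairings f U)

/-- `sup_s |h|`. -/
def supAbsOn (h : E2 → ℝ) (s : Set E2) : ℝ := sSup ((fun y => |h y|) '' s)

/-- The coordinates of a point of the plane, as a pair. -/
def coordEquiv : E2 ≃ᵐ ℝ × ℝ :=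
  (MeasurableEquiv.toLp 2 (Fin 2 → ℝ)).symm.trans MeasurableEquiv.finTwoArrow

theorem coordEquiv_apply (x : E2) : coordEquiv x = (x 0, x 1) := rfl

theorem measurePreserving_coordEquiv : MeasurePreserving coordEquiv volume volume :=
  (volume_preserving_finTwoArrow ℝ).comp
    (EuclideanSpace.volume_preserving_symm_measurableEquiv_toLp (Fin 2))

theorem integral_mul_coord (f g : ℝ → ℝ) :
    ∫ x : E2, f (x 0) * g (x 1) = (∫ t, f t) * ∫ t, g t := by
  rw [← integral_prod_mul f g]
  exact measurePreserving_coordEquiv.integral_comp coordEquiv.measurableEmbedding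
    (fun z : ℝ × ℝ => f z.1 * g z.2)

theorem sq_norm_eq_coord (x : E2) : ‖x‖ ^ 2 = x 0 ^ 2 + x 1 ^ 2 := by
  rw [EuclideanSpace.real_norm_sq_eq, Fin.sum_univ_two]

theorem pd_zero_mul_coord {f g : ℝ → ℝ} {x : E2} (hf : DifferentiableAt ℝ f (x 0))
    (hg : DifferentiableAt ℝ g (x 1)) :
    pd 0 (fun y : E2 => f (y 0) * g (y 1)) x = deriv f (x 0) * g (x 1) := by
  have h0 := HasDerivAt.comp_hasFDerivAt (f := fun y : E2 => y 0) x hf.hasDerivAt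
    (EuclideanSpace.proj 0 : E2 →L[ℝ] ℝ).hasFDerivAt
  have h1 := HasDerivAt.comp_hasFDerivAt (f := fun y : E2 => y 1) x hg.hasDerivAt
    (EuclideanSpace.proj 1 : E2 →L[ℝ] ℝ).hasFDerivAt
  have h : fderiv ℝ (fun y : E2 => f (y 0) * g (y 1)) x = _ := (h0.mul h1).fderiv
  rw [pd, h]
  simp [mul_comm]

/-- A power of the first coordinate with exponent at most `-1` is not integrable near a point
of the line `{x₀ = 0}`. -/
theorem not_integrableOn_ball_abs_coord_rpow {s : ℝ} (hs : s ≤ -1) {x : E2} (hx : x 0 = 0)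
    {r : ℝ} (hr : 0 < r) : ¬ IntegrableOn (fun y : E2 => |y 0| ^ s) (ball x r) volume := by
  intro h
  set S : Set (ℝ × ℝ) := Set.Ioo 0 (r / 2) ×ˢ Set.Ioo (x 1) (x 1 + r / 2) with hS
  have hsub : coordEquiv ⁻¹' S ⊆ ball x r := by
    rintro y ⟨⟨h1, h2⟩, h3, h4⟩
    simp only [coordEquiv_apply] at h1 h2 h3 h4
    rw [mem_ball, dist_eq_norm]
    refine lt_of_pow_lt_pow_left₀ 2 hr.le ?_
    rw [sq_norm_eq_coord]
    simp only [PiLp.sub_apply, hx]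
    nlinarith
  have h2 : IntegrableOn (fun z : ℝ × ℝ => |z.1| ^ s) S volume :=
    (measurePreserving_coordEquiv.integrableOn_comp_preimage
      coordEquiv.measurableEmbedding).1 (h.mono_set hsub)
  rw [IntegrableOn, Measure.volume_eq_prod, hS, ← Measure.prod_restrict] at h2
  have hne : (volume.restrict (Set.Ioo (x 1) (x 1 + r / 2))) ≠ 0 := by
    simp [Measure.restrict_eq_zero, hr]
  have : (ae (volume.restrict (Set.Ioo (x 1) (x 1 + r / 2)))).NeBot := ae_neBot.2 hne
  obtain ⟨y, hy⟩ := h2.prod_left_ae.exists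
  have h3 : IntegrableOn (fun t : ℝ => t ^ s) (Set.Ioo 0 (r / 2)) :=
    IntegrableOn.congr_fun (f := fun t : ℝ => |t| ^ s) hy
      (fun t ht => by simp only [abs_of_pos ht.1]) measurableSet_Ioo
  rw [intervalIntegral.integrableOn_Ioo_rpow_iff (by positivity)] at h3
  linarith

theorem le_add_rpow_mul_rpow {p l t : ℝ} (hp : 1 ≤ p) (hl : 0 < l) (ht : 0 ≤ t) :
    t ≤ l + l ^ (1 - p) * t ^ p := by
  rcases le_or_gt t l with h | h
  · have := mul_nonneg (Real.rpow_nonneg hl.le (1 - p)) (Real.rpow_nonneg ht p)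
    linarith
  · have ht0 : 0 < t := hl.trans h
    have h1 : t ^ (1 - p) ≤ l ^ (1 - p) :=
      Real.rpow_le_rpow_of_nonpos hl h.le (by linarith)
    have h2 : t ^ (1 - p) * t ^ p = t := by
      rw [← Real.rpow_add ht0]; simp
    have h3 := mul_le_mul_of_nonneg_right h1 (Real.rpow_nonneg ht p)
    linarith

/-- A smooth bump function supported in `(1, 2)`. -/
def sideBump : ContDiffBump (3 / 2 : ℝ) := ⟨1 / 8, 1 / 4, by norm_num, by norm_num⟩

/-- A smooth bump function supported in `(-2, 2)`. -/
def centerBump : ContDiffBump (0 : ℝ) := ⟨1, 2, by norm_num, by norm_num⟩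

theorem mem_Ioo_of_sideBump_ne_zero {t : ℝ} (h : sideBump t ≠ 0) :
    t ∈ Set.Ioo (5 / 4 : ℝ) (7 / 4) := by
  have h' : t ∈ Function.support sideBump := h
  rw [sideBump.support_eq, Real.ball_eq_Ioo] at h'
  simp only [sideBump, Set.mem_Ioo] at h' ⊢
  constructor <;> linarith [h'.1, h'.2]

theorem mem_Ioo_of_centerBump_ne_zero {t : ℝ} (h : centerBump t ≠ 0) :
    t ∈ Set.Ioo (-2 : ℝ) 2 := by
  have h' : t ∈ Function.support centerBump := h
  rw [centerBump.support_eq, Real.ball_eq_Ioo] at h'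
  simp only [centerBump, Set.mem_Ioo] at h' ⊢
  constructor <;> linarith [h'.1, h'.2]

theorem integral_abs_rpow_mul_deriv_sideBump_neg {a : ℝ} (ha : 0 < a) :
    ∫ t, |t| ^ a * deriv sideBump t < 0 := by
  have hsm : ContDiff ℝ 1 sideBump := sideBump.contDiff
  have hderiv : ∀ t, t ∉ Set.Ioc (1 : ℝ) 2 → deriv sideBump t = 0 := by
    intro t ht
    by_contra h
    have h1 : t ∈ tsupport sideBump := support_deriv_subset h
    rw [sideBump.tsupport_eq, Real.closedBall_eq_Icc] at h1
    simp only [sideBump, Set.mem_Icc] at h1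
    exact ht ⟨by linarith [h1.1], by linarith [h1.2]⟩
  have h1 : ∫ t, |t| ^ a * deriv sideBump t = ∫ t in (1 : ℝ)..2, t ^ a * deriv sideBump t := by
    rw [intervalIntegral.integral_of_le (by norm_num),
      ← setIntegral_eq_integral_of_forall_compl_eq_zero (s := Set.Ioc (1 : ℝ) 2)
        (fun t ht => by rw [hderiv t ht, mul_zero])]
    refine setIntegral_congr_fun measurableSet_Ioc fun t ht => ?_
    simp only [abs_of_pos (zero_lt_one.trans ht.1)]
  have hcont : ContinuousOn (fun t : ℝ => a * t ^ (a - 1)) (Set.Icc 1 2) := fun t ht =>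
    (continuousAt_const.mul (Real.continuousAt_rpow_const _ _
      (Or.inl (by linarith [ht.1])))).continuousWithinAt
  have huIcc : Set.uIcc (1 : ℝ) 2 = Set.Icc 1 2 := Set.uIcc_of_le (by norm_num)
  have h2 := intervalIntegral.integral_mul_deriv_eq_deriv_mul (a := 1) (b := 2)
    (u := fun t : ℝ => t ^ a) (v := sideBump) (u' := fun t => a * t ^ (a - 1))
    (v' := deriv sideBump)
    (fun t ht => Real.hasDerivAt_rpow_const (Or.inl (by
      rw [huIcc] at ht; linarith [ht.1])))
    (fun t _ => (hsm.differentiable (by norm_num) t).hasDerivAt)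
    (ContinuousOn.intervalIntegrable (by rwa [huIcc]))
    ((hsm.continuous_deriv le_rfl).intervalIntegrable _ _)
  have e1 : sideBump 1 = 0 := by
    by_contra h; have := (mem_Ioo_of_sideBump_ne_zero h).1; norm_num at this
  have e2 : sideBump 2 = 0 := by
    by_contra h; have := (mem_Ioo_of_sideBump_ne_zero h).2; norm_num at this
  rw [h1, h2, e1, e2]
  have h3 : 0 < ∫ t in (1 : ℝ)..2, a * t ^ (a - 1) * sideBump t := by
    refine intervalIntegral.integral_pos (by norm_num)
      (hcont.mul hsm.continuous.continuousOn) (fun t ht => ?_) ⟨3 / 2, by norm_num, ?_⟩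
    · have := sideBump.nonneg (x := t)
      have : 0 < t := by linarith [ht.1]
      positivity
    · rw [sideBump.one_of_mem_closedBall (mem_closedBall_self sideBump.rIn_pos.le)]
      positivity
  linarith

/-- The test function `sideBump (x₀ / δ) * centerBump x₁`. -/
def testBump (δ : ℝ) (x : E2) : ℝ := sideBump (x 0 / δ) * centerBump (x 1)

theorem contDiff_testBump (δ : ℝ) : ContDiff ℝ (⊤ : ℕ∞) (testBump δ) := by
  have h (i : Fin 2) : ContDiff ℝ (⊤ : ℕ∞) fun x : E2 => x i :=
    (EuclideanSpace.proj i : E2 →L[ℝ] ℝ).contDiff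
  exact (sideBump.contDiff.comp ((h 0).div_const δ)).mul (centerBump.contDiff.comp (h 1))

theorem testBump_nonneg (δ : ℝ) (x : E2) : 0 ≤ testBump δ x :=
  mul_nonneg sideBump.nonneg centerBump.nonneg

theorem testBump_le_one (δ : ℝ) (x : E2) : testBump δ x ≤ 1 :=
  mul_le_one₀ sideBump.le_one centerBump.nonneg centerBump.le_one

theorem testBump_eq_zero {δ : ℝ} (h0 : 0 < δ) (h1 : δ ≤ 1) {x : E2}
    (hx : x ∉ closedBall (0 : E2) 4) : testBump δ x = 0 := by
  by_contra h
  obtain ⟨ha, hb⟩ := mul_ne_zero_iff.1 h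
  obtain ⟨ha1, ha2⟩ := mem_Ioo_of_sideBump_ne_zero ha
  obtain ⟨hb1, hb2⟩ := mem_Ioo_of_centerBump_ne_zero hb
  rw [lt_div_iff₀ h0] at ha1
  rw [div_lt_iff₀ h0] at ha2
  refine hx (mem_closedBall_zero_iff.2 (le_of_sq_le_sq ?_ (by norm_num)))
  rw [sq_norm_eq_coord]
  nlinarith

theorem hasCompactSupport_testBump {δ : ℝ} (h0 : 0 < δ) (h1 : δ ≤ 1) :
    HasCompactSupport (testBump δ) :=
  HasCompactSupport.intro (isCompact_closedBall 0 4) fun _ => testBump_eq_zero h0 h1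

theorem integral_testBump {δ : ℝ} (h0 : 0 < δ) :
    ∫ x, testBump δ x = δ * (∫ t, sideBump t) * ∫ t, centerBump t := by
  have h := integral_mul_coord (fun t => sideBump (t / δ)) centerBump
  rw [Measure.integral_comp_div, abs_of_pos h0, smul_eq_mul] at h
  exact h

theorem integral_abs_rpow_mul_pd_testBump {δ a : ℝ} (h0 : 0 < δ) :
    ∫ x : E2, |x 0| ^ a * pd 0 (testBump δ) x =
      δ ^ a * (∫ t, |t| ^ a * deriv sideBump t) * ∫ t, centerBump t := by
  have hd (t : ℝ) : HasDerivAt (fun t => sideBump (t / δ)) (deriv sideBump (t / δ) * (1 / δ)) t :=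
    HasDerivAt.comp (h := fun t => t / δ) (h₂ := sideBump) t
      ((sideBump.contDiff (n := 1)).differentiable (by norm_num) (t / δ)).hasDerivAt
      ((hasDerivAt_id t).div_const δ)
  have h1 (x : E2) : |x 0| ^ a * pd 0 (testBump δ) x =
      (δ ^ a * (1 / δ) * (|x 0 / δ| ^ a * deriv sideBump (x 0 / δ))) * centerBump (x 1) := by
    have h := pd_zero_mul_coord (hd (x 0)).differentiableAt
      ((centerBump.contDiff (n := 1)).differentiable (by norm_num) (x 1))
    rw [(hd (x 0)).deriv] at h
    have h2 : δ ^ a * |x 0 / δ| ^ a = |x 0| ^ a := by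
      rw [← Real.mul_rpow h0.le (abs_nonneg _), abs_div, abs_of_pos h0, mul_div_cancel₀ _ h0.ne']
    rw [← h2]
    change _ * pd 0 (fun y : E2 => sideBump (y 0 / δ) * centerBump (y 1)) x = _
    rw [h]
    ring
  simp_rw [h1]
  rw [integral_mul_coord
    (fun t => δ ^ a * (1 / δ) * (|t / δ| ^ a * deriv sideBump (t / δ))) centerBump,
    integral_const_mul, Measure.integral_comp_div (fun t => |t| ^ a * deriv sideBump t),
    abs_of_pos h0, smul_eq_mul]
  field_simp

/-- A positive multiple of `|x₀| ^ a` is not in `W^{1,p}_loc` when `(1 - a) p > 1`. -/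
theorem not_memW1pLoc_abs_coord_rpow {p a c : ℝ} (hp : 1 ≤ p) (ha : 0 < a) (hc : 0 < c)
    (hap : 1 + (a - 1) * p < 0) : ¬ MemW1pLoc (fun x : E2 => c * |x 0| ^ a) p Set.univ := by
  rintro ⟨G, ⟨-, -, hG⟩, hGp⟩
  have hM := hGp (closedBall 0 4) (Set.subset_univ _) (isCompact_closedBall 0 4)
  set M := ∫ x in closedBall (0 : E2) 4, ‖G x‖ ^ p
  have hM0 : 0 ≤ M := integral_nonneg fun x => Real.rpow_nonneg (norm_nonneg _) p
  obtain ⟨κ, hκ⟩ : ∃ κ, κ = -(c * ∫ t, |t| ^ a * deriv sideBump t) := ⟨_, rfl⟩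
  have hκ0 : 0 < κ := by
    have := mul_neg_of_pos_of_neg hc (integral_abs_rpow_mul_deriv_sideBump_neg ha)
    linarith
  obtain ⟨A, hA⟩ : ∃ A, A = ∫ t, sideBump t := ⟨_, rfl⟩
  obtain ⟨B, hB⟩ : ∃ B, B = ∫ t, centerBump t := ⟨_, rfl⟩
  have hA0 : 0 < A := hA ▸ sideBump.integral_pos
  have hB0 : 0 < B := hB ▸ centerBump.integral_pos
  have key : ∀ δ, 0 < δ → δ ≤ 1 → ∀ l, 0 < l →
      δ ^ a * κ * B ≤ l * (δ * A * B) + l ^ (1 - p) * M := by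
    intro δ h0 h1 l hl
    have hw := hG (testBump δ) (contDiff_testBump δ) (hasCompactSupport_testBump h0 h1)
      (Set.subset_univ _) 0
    simp only [setIntegral_univ, mul_assoc c] at hw
    rw [integral_const_mul, integral_abs_rpow_mul_pd_testBump h0] at hw
    have hint : Integrable (testBump δ) :=
      (contDiff_testBump δ).continuous.integrable_of_hasCompactSupport
        (hasCompactSupport_testBump h0 h1)
    have hM' := (integrable_indicator_iff measurableSet_closedBall).2 hM
    have hbound := norm_integral_le_of_norm_le
      (f := fun x => G x 0 * testBump δ x) ((hint.const_mul l).add (hM'.const_mul (l ^ (1 - p))))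
      (Filter.Eventually.of_forall fun x => by
        have hφ := testBump_nonneg δ x
        have hφ1 := testBump_le_one δ x
        have hG0 : ‖G x 0‖ ≤ ‖G x‖ := PiLp.norm_apply_le (G x) 0
        simp only [Pi.add_apply, norm_mul, Real.norm_of_nonneg hφ]
        by_cases hx : x ∈ closedBall (0 : E2) 4
        · rw [Set.indicator_of_mem hx]
          have hy := le_add_rpow_mul_rpow hp hl (norm_nonneg (G x))
          have hn : 0 ≤ l ^ (1 - p) * ‖G x‖ ^ p := by positivity
          calc ‖G x 0‖ * testBump δ x
              ≤ (l + l ^ (1 - p) * ‖G x‖ ^ p) * testBump δ x := by gcongr; exact hG0.trans hy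
            _ ≤ _ := by nlinarith [mul_le_mul_of_nonneg_left hφ1 hn]
        · rw [Set.indicator_of_notMem hx, testBump_eq_zero h0 h1 hx]
          simp)
    rw [integral_add' (hint.const_mul l) (hM'.const_mul _), integral_const_mul,
      integral_const_mul, integral_indicator measurableSet_closedBall,
      integral_testBump h0, ← hA, ← hB] at hbound
    have hle := (le_abs_self _).trans hbound
    rw [← hB] at hw
    have : δ ^ a * κ * B = ∫ x, G x 0 * testBump δ x := by
      rw [hκ]; linarith
    rw [this]; exact hle
  set q := 1 + (a - 1) * p
  set L := κ / (2 * A)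
  have hL0 : 0 < L := by positivity
  have bound : ∀ δ, 0 < δ → δ ≤ 1 → δ ^ q ≤ L ^ (1 - p) * M / (κ * B / 2) := by
    intro δ h0 h1
    have h := key δ h0 h1 (L * δ ^ (a - 1)) (by positivity)
    have e1 : δ ^ (a - 1) * δ = δ ^ a := by
      rw [← Real.rpow_add_one h0.ne']; simp
    have e2 : L * δ ^ (a - 1) * (δ * A * B) = δ ^ a * (κ * B / 2) := by
      rw [← e1]; simp only [L]; field_simp
    have e3 : (L * δ ^ (a - 1)) ^ (1 - p) = L ^ (1 - p) * δ ^ ((a - 1) * (1 - p)) := by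
      rw [Real.mul_rpow hL0.le (by positivity), ← Real.rpow_mul h0.le]
    have e4 : δ ^ a = δ ^ q * δ ^ ((a - 1) * (1 - p)) := by
      rw [← Real.rpow_add h0]; congr 1; simp only [q]; ring
    rw [e2, e3] at h
    have h5 : δ ^ a * (κ * B / 2) ≤ L ^ (1 - p) * δ ^ ((a - 1) * (1 - p)) * M := by linarith
    rw [e4] at h5
    rw [le_div_iff₀ (by positivity)]
    refine le_of_mul_le_mul_right ?_ (Real.rpow_pos_of_pos h0 ((a - 1) * (1 - p)))
    linarith
  have htend := tendsto_rpow_neg_nhdsGT_zero hap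
  have hev := htend.eventually_gt_atTop (L ^ (1 - p) * M / (κ * B / 2))
  obtain ⟨δ, hδ, hδ0, hδ1⟩ := (hev.and (Ioc_mem_nhdsGT zero_lt_one)).exists
  exact absurd (bound δ hδ0 hδ1) (not_le.2 hδ)

/-- For `w(x₁,x₂) = -|x₁|^{4/3}`, so `|Dw| = (4/3)|x₁|^{1/3}` and
`|D|Dw|^α| = (α/3)(4/3)^α |x₁|^{(α-3)/3}` for `x₁ ≠ 0`: for every `p > 2` and every
`α ∈ (3/2, 3 - 3/p)`, the function `|D|Dw|^α|^p` is not locally integrable near the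
line `{x₁ = 0}`; consequently `|Dw|^α` has no weak gradient in `L^p_loc(ℝ²;ℝ²)`. -/
theorem statement9 (p α : ℝ) (hp : 2 < p) (hα1 : 3 / 2 < α) (hα2 : α < 3 - 3 / p) :
    (∀ x : E2, x 0 = 0 → ∀ r : ℝ, 0 < r →
      ¬ IntegrableOn
          (fun y : E2 => ((α / 3) * ((4 : ℝ) / 3) ^ α * |y 0| ^ ((α - 3) / 3)) ^ p)
          (ball x r) volume) ∧
    ¬ MemW1pLoc (fun x : E2 => ((4 : ℝ) / 3) ^ α * |x 0| ^ (α / 3)) p Set.univ := by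
  have hexp : (α - 3) / 3 * p < -1 := by
    rw [lt_sub_iff_add_lt, ← lt_sub_iff_add_lt', div_lt_iff₀ (by linarith)] at hα2
    linarith
  refine ⟨fun x hx r hr h => ?_, ?_⟩
  · have hC : 0 < α / 3 * ((4 : ℝ) / 3) ^ α := by positivity
    refine not_integrableOn_ball_abs_coord_rpow hexp.le hx hr ?_
    refine IntegrableOn.congr_fun
      (h.const_mul ((α / 3 * ((4 : ℝ) / 3) ^ α) ^ p)⁻¹) (fun y _ => ?_) measurableSet_ball
    simp only
    rw [Real.mul_rpow hC.le (by positivity), ← Real.rpow_mul (abs_nonneg _),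
      inv_mul_cancel_left₀ (by positivity)]
  · exact not_memW1pLoc_abs_coord_rpow (by linarith) (by linarith) (by positivity) (by linarith)
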